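/- Let Assumption 2 hold. Then for any observational data k(·,0) ∈ W^{1,∞}([0,T]), there exists a unique δ ∈ W^{1,∞}([0,T]) satisfying the Volterra integral equation, and a unique f ∈ L^∞([0,T]) given by the recovery formula f(t) = dδ(t)/dt + V(δ(t)/L)·k(t,0). -/

import Mathlib

open MeasureTheory Set Function

noncomputable section

/-- The bathtub kernel `w(y) = (1/L)·1_{[0,L]}(y)`. -/
def bathtubKernel (L : ℝ) : ℝ → ℝ :=
  (Set.Icc (0:ℝ) L).indicator fun _ => 1 / L

/-- Assumption 2: constant kernel data; `V` bounded, Lipschitz and nonnegative;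
`k̄` C² smooth, nonnegative, supported on `[0,L]`; `φ` C² smooth, nonnegative,
supported (in space) on `[0,L]`, with unit mass and `φ(t,0) > 0` for `t∈[0,T]`. -/
structure Assumption2 (T L : ℝ) (V kbar : ℝ → ℝ) (phi : ℝ → ℝ → ℝ) : Prop where
  hT : 0 < T
  hL : 0 < L
  V_bdd : ∃ M : ℝ, ∀ s : ℝ, |V s| ≤ M
  V_lip : ∃ K : NNReal, LipschitzWith K V
  V_nonneg : ∀ s : ℝ, 0 ≤ s → 0 ≤ V s
  kbar_smooth : ContDiff ℝ 2 kbar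
  kbar_nonneg : ∀ x : ℝ, 0 ≤ x → 0 ≤ kbar x
  kbar_supp : ∀ x : ℝ, L < x → kbar x = 0
  phi_smooth : ContDiff ℝ 2 (uncurry phi)
  phi_nonneg : ∀ t x : ℝ, 0 ≤ t → 0 ≤ x → 0 ≤ phi t x
  phi_supp : ∀ t x : ℝ, L < x → phi t x = 0
  phi_total : ∀ t ∈ Icc (0:ℝ) T, (∫ x in Ici (0:ℝ), phi t x) = 1
  phi_pos : ∀ t ∈ Icc (0:ℝ) T, 0 < phi t 0

/-- A strong solution of the generalized bathtub model on `[0,T]×[0,∞)` with the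
kernel `w = (1/L)·1_{[0,L]}`. -/
def IsStrongSolutionT (T L : ℝ) (V f kbar : ℝ → ℝ) (phi : ℝ → ℝ → ℝ)
    (k : ℝ → ℝ → ℝ) : Prop :=
  (∃ K : NNReal, LipschitzOnWith K (uncurry k) (Icc 0 T ×ˢ Ici 0)) ∧
  (∀ t ∈ Icc (0:ℝ) T, ∀ x ∈ Ici (0:ℝ), 0 ≤ k t x) ∧
  (∀ x ∈ Ici (0:ℝ), k 0 x = kbar x) ∧
  (∀ t ∈ Icc (0:ℝ) T, ∀ x ∈ Ici (0:ℝ), ∃ kt kx : ℝ,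
    HasDerivWithinAt (fun s => k s x) kt (Icc 0 T) t ∧
    HasDerivWithinAt (fun y => k t y) kx (Ici 0) x ∧
    kt - V (∫ y in Ici (0:ℝ), k t y * bathtubKernel L y) * kx = f t * phi t x)

/-- The right-hand side of the nonlinear Volterra integral equation (3.5):
here `kb` is the boundary datum `t ↦ k(t,0)`, `δ` the unknown, and
`v^δ(s) = V(δ(s)/L)`. -/
def volterraRHS (L : ℝ) (V kbar : ℝ → ℝ) (phi : ℝ → ℝ → ℝ)
    (kb δ : ℝ → ℝ) (t : ℝ) : ℝ :=
  (1 / phi t 0) * (kb t - kbar (∫ τ in (0:ℝ)..t, V (δ τ / L))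
      + (∫ x in Ici (0:ℝ), kbar x) * phi 0 (∫ τ in (0:ℝ)..t, V (δ τ / L)))
  - (1 / phi t 0) * (∫ τ in (0:ℝ)..t,
      (V (δ τ / L) * kb τ * phi τ (∫ s in τ..t, V (δ s / L))
        + V (δ τ / L) * δ τ * deriv (phi τ) (∫ s in τ..t, V (δ s / L))))
  + (1 / phi t 0) * ∫ τ in (0:ℝ)..t,
      δ τ * deriv (fun s => phi s (∫ s' in τ..t, V (δ s' / L))) τ

open Filter Topology

/-- Grönwall's inequality in integral form. -/
lemma abs_le_of_abs_le_add_integral {T A C : ℝ} {w : ℝ → ℝ} (hA : 0 ≤ A) (hC : 0 ≤ C)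
    (hw : Continuous w) (h : ∀ t ∈ Icc 0 T, |w t| ≤ A + C * ∫ s in (0:ℝ)..t, |w s|) :
    ∀ t ∈ Icc 0 T, |w t| ≤ A + C * gronwallBound 0 C A T := by
  have key : ∀ t ∈ Icc 0 T, ‖∫ s in (0:ℝ)..t, |w s|‖ ≤ gronwallBound 0 C A (t - 0) := by
    refine norm_le_gronwallBound_of_norm_deriv_right_le (f' := fun t => |w t|) ?_ ?_ ?_ ?_
    · exact (intervalIntegral.continuous_primitive
        (fun a b => hw.abs.intervalIntegrable a b) 0).continuousOn
    · exact fun t _ => (intervalIntegral.integral_hasDerivAt_right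
        (hw.abs.intervalIntegrable _ _) hw.abs.stronglyMeasurable.stronglyMeasurableAtFilter
        hw.abs.continuousAt).hasDerivWithinAt
    · simp
    · intro t ht
      have := h t (Ico_subset_Icc_self ht)
      rw [Real.norm_eq_abs, abs_abs, Real.norm_eq_abs]
      nlinarith [le_abs_self (∫ s in (0:ℝ)..t, |w s|)]
  intro t ht
  refine (h t ht).trans ?_
  gcongr
  refine (le_abs_self _).trans ((key t ht).trans ?_)
  rw [sub_zero]
  exact gronwallBound_mono le_rfl hA hC ht.2

/-- A map of Volterra type on `C([0, T])` has exactly one fixed point. -/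
lemma existsUnique_isFixedPt_of_volterra {T C : ℝ} (hT : 0 ≤ T) (hC : 0 ≤ C)
    (Φ : C(Icc 0 T, ℝ) → C(Icc 0 T, ℝ))
    (h : ∀ u v : C(Icc 0 T, ℝ), ∀ t : Icc 0 T, |Φ u t - Φ v t| ≤
      C * ∫ s in (0:ℝ)..t, |IccExtend hT u s - IccExtend hT v s|) :
    ∃! u, IsFixedPt Φ u := by
  have iter : ∀ (n : ℕ) (u v : C(Icc 0 T, ℝ)) (t : Icc 0 T),
      |Φ^[n] u t - Φ^[n] v t| ≤ (C * t) ^ n / n.factorial * dist u v := by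
    intro n u v
    induction n with
    | zero => intro t; simpa [← Real.dist_eq] using ContinuousMap.dist_apply_le_dist (f := u) (g := v) t
    | succ n ih =>
      intro t
      rw [iterate_succ_apply', iterate_succ_apply']
      refine (h _ _ t).trans ?_
      have hmono : ∫ s in (0:ℝ)..t, |IccExtend hT (Φ^[n] u) s - IccExtend hT (Φ^[n] v) s| ≤
          ∫ s in (0:ℝ)..t, (C ^ n / n.factorial * dist u v) * s ^ n := by
        apply intervalIntegral.integral_mono_on t.2.1
        · exact ((ContinuousMap.continuous _).Icc_extend'.sub
            (ContinuousMap.continuous _).Icc_extend').abs.intervalIntegrable _ _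
        · exact Continuous.intervalIntegrable (by fun_prop) _ _
        · intro s hs
          have hs' : s ∈ Icc 0 T := ⟨hs.1, hs.2.trans t.2.2⟩
          rw [IccExtend_of_mem _ _ hs', IccExtend_of_mem _ _ hs']
          refine (ih ⟨s, hs'⟩).trans_eq ?_
          simp only [mul_pow]
          ring
      refine (mul_le_mul_of_nonneg_left hmono hC).trans_eq ?_
      rw [intervalIntegral.integral_const_mul, integral_pow, Nat.factorial_succ]
      push_cast
      field_simp
      ring
  obtain ⟨n, hn⟩ := ((FloorSemiring.tendsto_pow_div_factorial_atTop (C * T)).eventually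
    (gt_mem_nhds zero_lt_one)).exists
  have hn0 : 0 ≤ (C * T) ^ n / n.factorial := by positivity
  have hcontr : ContractingWith (Real.toNNReal ((C * T) ^ n / n.factorial)) Φ^[n] := by
    refine ⟨by simpa using hn, LipschitzWith.of_dist_le_mul fun u v => ?_⟩
    rw [Real.coe_toNNReal _ hn0, ContinuousMap.dist_le (by positivity)]
    intro t
    rw [Real.dist_eq]
    refine (iter n u v t).trans ?_
    have := t.2.1
    have := t.2.2
    gcongr
  have : Nonempty (C(Icc 0 T, ℝ)) := ⟨0⟩
  exact ⟨_, hcontr.isFixedPt_fixedPoint_iterate,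
    fun v hv => hcontr.fixedPoint_unique (hv.iterate n)⟩

lemma abs_integral_le_of_abs_le_const {f : ℝ → ℝ} {a b C : ℝ} (h : ∀ x ∈ uIoc a b, |f x| ≤ C) :
    |∫ x in a..b, f x| ≤ C * |b - a| := by
  rw [← Real.norm_eq_abs]
  exact intervalIntegral.norm_integral_le_of_norm_le_const h

lemma continuous_integral_left {f : ℝ → ℝ} (hf : Continuous f) (t : ℝ) :
    Continuous fun τ => ∫ s in τ..t, f s := by
  simp_rw [fun τ => intervalIntegral.integral_symm (f := f) (μ := volume) t τ]
  exact (intervalIntegral.continuous_primitive (fun a b => hf.intervalIntegrable a b) t).neg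

/-- The abstract nonlinear Volterra operator
`u ↦ q t * (b t + H (∫₀ᵗ W(u)) - ∫₀ᵗ g(τ, u τ, ∫_τ^t W(u)) dτ)`. -/
def volterraOp (q b H W : ℝ → ℝ) (g : ℝ × ℝ × ℝ → ℝ) (u : ℝ → ℝ) (t : ℝ) : ℝ :=
  q t * (b t + H (∫ s in (0:ℝ)..t, W (u s)) -
    ∫ τ in (0:ℝ)..t, g (τ, u τ, ∫ s in τ..t, W (u s)))

lemma continuous_volterraKernel {W : ℝ → ℝ} {g : ℝ × ℝ × ℝ → ℝ} (hW : Continuous W)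
    (hg : Continuous g) {u : ℝ → ℝ} (hu : Continuous u) (t : ℝ) :
    Continuous fun τ => g (τ, u τ, ∫ s in τ..t, W (u s)) :=
  hg.comp (continuous_id.prodMk (hu.prodMk (continuous_integral_left (hW.comp hu) t)))

lemma volterraOp_sub_le {q b H W : ℝ → ℝ} {g : ℝ × ℝ × ℝ → ℝ} {T Q : ℝ} {KH KW Kg : NNReal}
    (hQ : ∀ t, |q t| ≤ Q) (hH : LipschitzWith KH H) (hW : LipschitzWith KW W)
    (hg : LipschitzWith Kg g) {u v : ℝ → ℝ} (hu : Continuous u) (hv : Continuous v)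
    {t : ℝ} (ht : t ∈ Icc 0 T) :
    |volterraOp q b H W g u t - volterraOp q b H W g v t| ≤
      Q * (KH * KW + Kg * (1 + T * KW)) * ∫ s in (0:ℝ)..t, |u s - v s| := by
  set e := ∫ s in (0:ℝ)..t, |u s - v s| with he
  have he0 : 0 ≤ e := intervalIntegral.integral_nonneg ht.1 fun s _ => abs_nonneg _
  have hQ0 : 0 ≤ Q := (abs_nonneg _).trans (hQ 0)
  have hcu : Continuous fun s => W (u s) := hW.continuous.comp hu
  have hcv : Continuous fun s => W (v s) := hW.continuous.comp hv
  have huv : Continuous fun s => |u s - v s| := (hu.sub hv).abs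
  have hWint : ∀ a ∈ Icc 0 t, |(∫ s in a..t, W (u s)) - ∫ s in a..t, W (v s)| ≤ KW * e := by
    intro a ha
    rw [← intervalIntegral.integral_sub (hcu.intervalIntegrable _ _) (hcv.intervalIntegrable _ _)]
    refine (intervalIntegral.abs_integral_le_integral_abs ha.2).trans ?_
    calc ∫ s in a..t, |W (u s) - W (v s)| ≤ ∫ s in a..t, KW * |u s - v s| := by
          refine intervalIntegral.integral_mono_on ha.2 ((hcu.sub hcv).abs.intervalIntegrable _ _)
            ((huv.const_mul _).intervalIntegrable _ _) fun s _ => ?_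
          simpa [Real.dist_eq] using hW.dist_le_mul (u s) (v s)
      _ = KW * ∫ s in a..t, |u s - v s| := intervalIntegral.integral_const_mul _ _
      _ ≤ KW * e := by
          gcongr
          exact intervalIntegral.integral_mono_interval ha.1 ha.2 le_rfl
            (Eventually.of_forall fun s => abs_nonneg _) (huv.intervalIntegrable _ _)
  have hHe : |H (∫ s in (0:ℝ)..t, W (u s)) - H (∫ s in (0:ℝ)..t, W (v s))| ≤ KH * (KW * e) := by
    have h1 := hH.dist_le_mul (∫ s in (0:ℝ)..t, W (u s)) (∫ s in (0:ℝ)..t, W (v s))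
    rw [Real.dist_eq, Real.dist_eq] at h1
    exact h1.trans (by gcongr; exact hWint 0 ⟨le_rfl, ht.1⟩)
  have hge : |(∫ τ in (0:ℝ)..t, g (τ, u τ, ∫ s in τ..t, W (u s))) -
      ∫ τ in (0:ℝ)..t, g (τ, v τ, ∫ s in τ..t, W (v s))| ≤ Kg * (1 + T * KW) * e := by
    have hku := continuous_volterraKernel hW.continuous hg.continuous hu t
    have hkv := continuous_volterraKernel hW.continuous hg.continuous hv t
    rw [← intervalIntegral.integral_sub (hku.intervalIntegrable _ _) (hkv.intervalIntegrable _ _)]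
    refine (intervalIntegral.abs_integral_le_integral_abs ht.1).trans ?_
    calc _ ≤ ∫ s in (0:ℝ)..t, Kg * (|u s - v s| + KW * e) := by
          refine intervalIntegral.integral_mono_on ht.1 ((hku.sub hkv).abs.intervalIntegrable _ _)
            (((huv.add continuous_const).const_mul _).intervalIntegrable _ _) fun s hs => ?_
          have h1 := hg.dist_le_mul (s, u s, ∫ σ in s..t, W (u σ)) (s, v s, ∫ σ in s..t, W (v σ))
          rw [Real.dist_eq] at h1
          refine h1.trans ?_
          gcongr
          simp only [Prod.dist_eq, dist_self, Real.dist_eq]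
          have h2 := hWint s hs
          have h3 : 0 ≤ KW * e := by positivity
          have h4 := abs_nonneg (u s - v s)
          refine max_le (by linarith) (max_le (by linarith) (by linarith))
      _ = Kg * (e + t * (KW * e)) := by
          rw [intervalIntegral.integral_const_mul, intervalIntegral.integral_add
            (huv.intervalIntegrable _ _) (continuous_const.intervalIntegrable _ _),
            intervalIntegral.integral_const, smul_eq_mul, sub_zero]
      _ ≤ Kg * (e + T * (KW * e)) := by gcongr; exact ht.2
      _ = _ := by ring
  rw [volterraOp, volterraOp, ← mul_sub, abs_mul]
  calc _ ≤ Q * (KH * (KW * e) + Kg * (1 + T * KW) * e) := by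
        gcongr
        · exact hQ t
        · rw [abs_le] at *
          constructor <;> linarith [hHe.1, hHe.2, hge.1, hge.2]
    _ = _ := by ring

lemma LocallyLipschitz.mul_real {α : Type*} [PseudoEMetricSpace α] {f g : α → ℝ}
    (hf : LocallyLipschitz f) (hg : LocallyLipschitz g) :
    LocallyLipschitz fun x => f x * g x :=
  (contDiff_mul (𝕜 := ℝ) (𝔸 := ℝ) (n := 1)).locallyLipschitz.comp (hf.prodMk hg)

lemma LipschitzOnWith.exists_mul_real {f g : ℝ → ℝ} {s : Set ℝ} {Kf Kg : NNReal}
    (hs : IsCompact s) (hf : LipschitzOnWith Kf f s) (hg : LipschitzOnWith Kg g s) :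
    ∃ K, LipschitzOnWith K (fun x => f x * g x) s := by
  have h := (LocallyLipschitz.mul_real (LipschitzWith.locallyLipschitz hf.to_restrict)
      (LipschitzWith.locallyLipschitz hg.to_restrict))
  have := isCompact_iff_compactSpace.mp hs
  obtain ⟨K, hK⟩ := h.locallyLipschitzOn.exists_lipschitzOnWith_of_compact isCompact_univ
  refine ⟨K, lipschitzOnWith_iff_restrict.mpr ?_⟩
  rwa [lipschitzOnWith_univ] at hK

lemma exists_lipschitzOnWith_volterraOp {q b H W : ℝ → ℝ} {g : ℝ × ℝ × ℝ → ℝ} {T M B : ℝ}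
    {Kq Kb KH KW Kg : NNReal} (hq : LipschitzWith Kq q) (hb : LipschitzWith Kb b)
    (hH : LipschitzWith KH H) (hW : LipschitzWith KW W) (hWM : ∀ x, |W x| ≤ M)
    (hg : LipschitzWith Kg g) (hgB : ∀ p, |g p| ≤ B) {u : ℝ → ℝ} (hu : Continuous u) :
    ∃ K, LipschitzOnWith K (volterraOp q b H W g u) (Icc 0 T) := by
  have hcu : Continuous fun s => W (u s) := hW.continuous.comp hu
  have hM : 0 ≤ M := (abs_nonneg _).trans (hWM 0)
  have hB : 0 ≤ B := (abs_nonneg _).trans (hgB 0)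
  have hWint : ∀ a s t, |(∫ σ in a..t, W (u σ)) - ∫ σ in a..s, W (u σ)| ≤ M * |t - s| := by
    intro a s t
    rw [intervalIntegral.integral_interval_sub_left (hcu.intervalIntegrable _ _)
      (hcu.intervalIntegrable _ _)]
    exact abs_integral_le_of_abs_le_const fun x _ => hWM _
  have hP : LipschitzWith (Real.toNNReal M) fun t => ∫ s in (0:ℝ)..t, W (u s) :=
    LipschitzWith.of_dist_le_mul fun t s => by
      rw [Real.coe_toNNReal _ hM]
      exact hWint 0 s t
  have hI : ∃ K, LipschitzOnWith K
      (fun t => ∫ τ in (0:ℝ)..t, g (τ, u τ, ∫ s in τ..t, W (u s))) (Icc 0 T) := by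
    refine ⟨Real.toNNReal (B + Kg * M * T), LipschitzOnWith.of_dist_le_mul fun t ht s hs => ?_⟩
    have hT : 0 ≤ T := ht.1.trans ht.2
    rw [Real.coe_toNNReal _ (by positivity), Real.dist_eq, Real.dist_eq]
    have hkt := continuous_volterraKernel hW.continuous hg.continuous hu t
    have hks := continuous_volterraKernel hW.continuous hg.continuous hu s
    have h1 : |∫ τ in s..t, g (τ, u τ, ∫ σ in τ..t, W (u σ))| ≤ B * |t - s| :=
      abs_integral_le_of_abs_le_const fun x _ => hgB _
    have h2 : |∫ τ in (0:ℝ)..s, (g (τ, u τ, ∫ σ in τ..t, W (u σ)) -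
        g (τ, u τ, ∫ σ in τ..s, W (u σ)))| ≤ Kg * (M * |t - s|) * |s - 0| := by
      refine abs_integral_le_of_abs_le_const fun τ _ => ?_
      have h3 := hg.dist_le_mul (τ, u τ, ∫ σ in τ..t, W (u σ)) (τ, u τ, ∫ σ in τ..s, W (u σ))
      rw [dist_eq_norm] at h3
      refine h3.trans ?_
      gcongr
      simp only [Prod.dist_eq, dist_self, Real.dist_eq]
      exact max_le (by positivity) (max_le (by positivity) (hWint _ _ _))
    have h4 : Kg * (M * |t - s|) * |s - 0| ≤ Kg * (M * |t - s|) * T := by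
      rw [sub_zero, abs_of_nonneg hs.1]
      gcongr
      exact hs.2
    rw [intervalIntegral.integral_sub (hkt.intervalIntegrable _ _)
      (hks.intervalIntegrable _ _)] at h2
    rw [← intervalIntegral.integral_add_adjacent_intervals (hkt.intervalIntegrable 0 s)
      (hkt.intervalIntegrable s t)]
    rw [abs_le] at *
    constructor <;> nlinarith [h1.1, h1.2, h2.1, h2.2]
  obtain ⟨KI, hKI⟩ := hI
  exact hq.lipschitzOnWith.exists_mul_real isCompact_Icc
    ((hb.add (hH.comp hP)).lipschitzOnWith.sub hKI)

/-- A priori bound for solutions of Volterra equations whose kernel has linear growth. -/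
lemma abs_le_of_eq_volterraOp {q b H W : ℝ → ℝ} {g : ℝ × ℝ × ℝ → ℝ} {T Q B A : ℝ}
    (hT : 0 ≤ T) (hQ : ∀ t, |q t| ≤ Q) (hb : ∀ t, |b t| ≤ B) (hH : ∀ x, |H x| ≤ B)
    (hW : Continuous W) (hg : Continuous g) (hgA : ∀ p, |g p| ≤ A + A * |p.2.1|)
    {u : ℝ → ℝ} (hu : Continuous u) (heq : ∀ t ∈ Icc 0 T, u t = volterraOp q b H W g u t) :
    ∀ t ∈ Icc 0 T, |u t| ≤ Q * (2 * B + A * T) + Q * A *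
      gronwallBound 0 (Q * A) (Q * (2 * B + A * T)) T := by
  have hQ0 : 0 ≤ Q := (abs_nonneg _).trans (hQ 0)
  have hB0 : 0 ≤ B := (abs_nonneg _).trans (hb 0)
  have hA0 : 0 ≤ A := by simpa using (abs_nonneg _).trans (hgA 0)
  refine abs_le_of_abs_le_add_integral (by positivity) (by positivity) hu fun t ht => ?_
  have hk := continuous_volterraKernel hW hg hu t
  have h1 : |∫ τ in (0:ℝ)..t, g (τ, u τ, ∫ s in τ..t, W (u s))| ≤
      A * T + A * ∫ s in (0:ℝ)..t, |u s| := by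
    refine (intervalIntegral.abs_integral_le_integral_abs ht.1).trans ?_
    calc _ ≤ ∫ τ in (0:ℝ)..t, (A + A * |u τ|) :=
          intervalIntegral.integral_mono_on ht.1 (hk.abs.intervalIntegrable _ _)
            ((continuous_const.add (hu.abs.const_mul _)).intervalIntegrable _ _) fun s _ => hgA _
      _ = t * A + A * ∫ s in (0:ℝ)..t, |u s| := by
          rw [intervalIntegral.integral_add (continuous_const.intervalIntegrable _ _)
            ((hu.abs.const_mul _).intervalIntegrable _ _), intervalIntegral.integral_const_mul]
          simp
      _ ≤ _ := by nlinarith [ht.2]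
  rw [heq t ht, volterraOp, abs_mul]
  calc _ ≤ Q * (B + B + (A * T + A * ∫ s in (0:ℝ)..t, |u s|)) := by
        gcongr
        · exact hQ t
        · refine (abs_sub _ _).trans (add_le_add ((abs_add_le _ _).trans
            (add_le_add (hb t) (hH _))) h1)
    _ = _ := by ring

/-- Well-posedness of the Volterra equation with bounded Lipschitz data. -/
lemma existsUnique_eq_volterraOp {q b H W : ℝ → ℝ} {g : ℝ × ℝ × ℝ → ℝ} {T Q M B : ℝ}
    {Kq Kb KH KW Kg : NNReal} (hT : 0 ≤ T) (hq : LipschitzWith Kq q) (hQ : ∀ t, |q t| ≤ Q)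
    (hb : LipschitzWith Kb b) (hH : LipschitzWith KH H) (hW : LipschitzWith KW W)
    (hWM : ∀ x, |W x| ≤ M) (hg : LipschitzWith Kg g) (hgB : ∀ p, |g p| ≤ B) :
    ∃! u : C(Icc 0 T, ℝ), ∀ t ∈ Icc 0 T,
      IccExtend hT u t = volterraOp q b H W g (IccExtend hT u) t := by
  have hext : ∀ u : C(Icc 0 T, ℝ), Continuous (IccExtend hT u) := fun u =>
    u.continuous.Icc_extend'
  let Φ : C(Icc 0 T, ℝ) → C(Icc 0 T, ℝ) := fun u =>
    ⟨fun t => volterraOp q b H W g (IccExtend hT u) t, by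
      obtain ⟨K, hK⟩ := exists_lipschitzOnWith_volterraOp (T := T) hq hb hH hW hWM hg hgB (hext u)
      exact continuousOn_iff_continuous_domRestrict.mp hK.continuousOn⟩
  have hQ0 : 0 ≤ Q := (abs_nonneg _).trans (hQ 0)
  have h := existsUnique_isFixedPt_of_volterra hT
    (C := Q * (KH * KW + Kg * (1 + T * KW))) (by positivity) Φ
    fun u v t => volterraOp_sub_le hQ hH hW hg (hext u) (hext v) t.2
  refine (existsUnique_congr fun u => ?_).mp h
  constructor
  · intro hu t ht
    conv_lhs => rw [← hu.eq]
    rw [IccExtend_of_mem _ _ ht]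
    rfl
  · intro hu
    ext t
    refine (hu t t.2).symm.trans ?_
    rw [IccExtend_of_mem _ _ t.2]

lemma exists_lipschitzWith_comp_of_compact {α β γ : Type*} [PseudoMetricSpace α]
    [PseudoMetricSpace β] [PseudoMetricSpace γ] {f : β → γ} {π : α → β} {s : Set β} {K : NNReal}
    (hf : LocallyLipschitzOn s f) (hs : IsCompact s) (hπ : LipschitzWith K π) (h : ∀ x, π x ∈ s) :
    ∃ K', LipschitzWith K' fun x => f (π x) := by
  obtain ⟨K', hK'⟩ := hf.exists_lipschitzOnWith_of_compact hs
  exact ⟨K' * K, lipschitzOnWith_univ.mp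
    (hK'.comp (lipschitzOnWith_univ.mpr hπ) fun x _ => h x)⟩

lemma lipschitzWith_coe_projIcc {a b : ℝ} (h : a ≤ b) :
    LipschitzWith 1 fun x => (projIcc a b h x : ℝ) := by
  rw [← one_mul (1 : NNReal)]
  exact (LipschitzWith.subtype_val (Icc a b)).comp (LipschitzWith.projIcc h)

lemma abs_projIcc_le_abs {R : ℝ} (h : -R ≤ R) (x : ℝ) : |(projIcc (-R) R h x : ℝ)| ≤ |x| := by
  have hR : 0 ≤ R := by linarith
  rw [coe_projIcc, abs_le]
  constructor
  · exact le_max_of_le_right (le_min (by linarith [abs_nonneg x]) (neg_abs_le x))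
  · exact max_le (by linarith [abs_nonneg x]) ((min_le_right _ _).trans (le_abs_self x))

lemma deriv_snd_eq_fderiv {phi : ℝ → ℝ → ℝ} (h : ContDiff ℝ 2 (uncurry phi)) (t x : ℝ) :
    deriv (phi t) x = fderiv ℝ (uncurry phi) (t, x) (0, 1) := by
  have h1 := ((h.differentiable (by norm_num)) (t, x)).hasFDerivAt
  exact (h1.comp_hasDerivAt x ((hasDerivAt_const x t).prodMk (hasDerivAt_id x))).deriv

lemma deriv_fst_eq_fderiv {phi : ℝ → ℝ → ℝ} (h : ContDiff ℝ 2 (uncurry phi)) (t x : ℝ) :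
    deriv (fun s => phi s x) t = fderiv ℝ (uncurry phi) (t, x) (1, 0) := by
  have h1 := ((h.differentiable (by norm_num)) (t, x)).hasFDerivAt
  exact (h1.comp_hasDerivAt t ((hasDerivAt_id t).prodMk (hasDerivAt_const t x))).deriv

lemma contDiff_fderiv_apply_const {f : ℝ × ℝ → ℝ} (h : ContDiff ℝ 2 f) (v : ℝ × ℝ) :
    ContDiff ℝ 1 fun p => fderiv ℝ f p v :=
  (h.fderiv_right (m := 1) (by norm_num)).clm_apply contDiff_const

lemma contDiff_deriv_snd {phi : ℝ → ℝ → ℝ} (h : ContDiff ℝ 2 (uncurry phi)) :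
    ContDiff ℝ 1 fun p : ℝ × ℝ => deriv (phi p.1) p.2 := by
  simp_rw [deriv_snd_eq_fderiv h]
  exact contDiff_fderiv_apply_const h _

lemma contDiff_deriv_fst {phi : ℝ → ℝ → ℝ} (h : ContDiff ℝ 2 (uncurry phi)) :
    ContDiff ℝ 1 fun p : ℝ × ℝ => deriv (fun s => phi s p.2) p.1 := by
  simp_rw [deriv_fst_eq_fderiv h]
  exact contDiff_fderiv_apply_const h _

/-- The integrand of the bathtub Volterra equation at `(τ, δ, x)`. -/
def bathtubIntegrand (L : ℝ) (V : ℝ → ℝ) (phi : ℝ → ℝ → ℝ) (b : ℝ → ℝ) (p : ℝ × ℝ × ℝ) : ℝ :=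
  V (p.2.1 / L) * b p.1 * phi p.1 p.2.2 + V (p.2.1 / L) * p.2.1 * deriv (phi p.1) p.2.2 -
    p.2.1 * deriv (fun s => phi s p.2.2) p.1

lemma locallyLipschitz_bathtubIntegrand {L : ℝ} {V : ℝ → ℝ} {phi : ℝ → ℝ → ℝ} {b : ℝ → ℝ}
    {KV Kb : NNReal} (hV : LipschitzWith KV V) (hphi : ContDiff ℝ 2 (uncurry phi))
    (hb : LipschitzWith Kb b) : LocallyLipschitz (bathtubIntegrand L V phi b) := by
  have hd : LocallyLipschitz fun p : ℝ × ℝ × ℝ => p.2.1 :=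
    (contDiff_fst.comp contDiff_snd : ContDiff ℝ 1 fun p : ℝ × ℝ × ℝ => p.2.1).locallyLipschitz
  have hW : LocallyLipschitz fun p : ℝ × ℝ × ℝ => V (p.2.1 / L) :=
    hV.locallyLipschitz.comp ((contDiff_fst.comp contDiff_snd).div_const L :
      ContDiff ℝ 1 fun p : ℝ × ℝ × ℝ => p.2.1 / L).locallyLipschitz
  have hb' : LocallyLipschitz fun p : ℝ × ℝ × ℝ => b p.1 :=
    hb.locallyLipschitz.comp (contDiff_fst : ContDiff ℝ 1 fun p : ℝ × ℝ × ℝ => p.1).locallyLipschitz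
  have hpair : ContDiff ℝ 1 fun p : ℝ × ℝ × ℝ => (p.1, p.2.2) := by fun_prop
  have hp := ((hphi.of_le (by norm_num)).comp hpair).locallyLipschitz
  have hp1 := ((contDiff_deriv_fst hphi).comp hpair).locallyLipschitz
  have hp2 := ((contDiff_deriv_snd hphi).comp hpair).locallyLipschitz
  exact (((hW.mul_real hb').mul_real hp).add ((hW.mul_real hd).mul_real hp2)).sub
    (hd.mul_real hp1)

lemma volterraRHS_congr {T L : ℝ} {V kbar : ℝ → ℝ} {phi : ℝ → ℝ → ℝ} {kb u v : ℝ → ℝ}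
    (h : EqOn u v (Icc 0 T)) {t : ℝ} (ht : t ∈ Icc 0 T) :
    volterraRHS L V kbar phi kb u t = volterraRHS L V kbar phi kb v t := by
  have hmem : ∀ a ∈ Icc 0 t, ∀ s ∈ uIcc a t, s ∈ Icc 0 T := by
    intro a ha s hs
    rw [uIcc_of_le ha.2] at hs
    exact ⟨ha.1.trans hs.1, hs.2.trans ht.2⟩
  have hinteg : ∀ a ∈ Icc 0 t, ∫ s in a..t, V (u s / L) = ∫ s in a..t, V (v s / L) :=
    fun a ha => intervalIntegral.integral_congr fun s hs => by simp only [h (hmem a ha s hs)]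
  have h0 : (0:ℝ) ∈ Icc 0 t := ⟨le_rfl, ht.1⟩
  rw [volterraRHS, volterraRHS, hinteg 0 h0]
  congr 2
  · congr 1
    refine intervalIntegral.integral_congr fun τ hτ => ?_
    have hτ' : τ ∈ Icc 0 t := by rwa [uIcc_of_le ht.1] at hτ
    simp only [h (hmem 0 h0 τ hτ), hinteg τ hτ']
  · refine intervalIntegral.integral_congr fun τ hτ => ?_
    have hτ' : τ ∈ Icc 0 t := by rwa [uIcc_of_le ht.1] at hτ
    simp only [h (hmem 0 h0 τ hτ), hinteg τ hτ']

lemma volterraRHS_eq_volterraOp {T L M X : ℝ} {V kbar : ℝ → ℝ} {phi : ℝ → ℝ → ℝ} {kb u : ℝ → ℝ}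
    (hT : 0 ≤ T) (hX : -X ≤ X) (hMX : M * T ≤ X) (hV : Continuous V) (hVM : ∀ s, |V s| ≤ M)
    (hphi : ContDiff ℝ 2 (uncurry phi)) (hkb : ContinuousOn kb (Icc 0 T)) (hu : Continuous u)
    {t : ℝ} (ht : t ∈ Icc 0 T) :
    volterraRHS L V kbar phi kb u t = volterraOp (fun t => 1 / phi (projIcc 0 T hT t) 0)
      (fun t => kb (projIcc 0 T hT t))
      (fun x => -kbar (projIcc (-X) X hX x) +
        (∫ y in Ici (0:ℝ), kbar y) * phi 0 (projIcc (-X) X hX x))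
      (fun d => V (d / L))
      (fun p => bathtubIntegrand L V phi (fun t => kb (projIcc 0 T hT t))
        (projIcc 0 T hT p.1, p.2.1, projIcc (-X) X hX p.2.2)) u t := by
  have hM : 0 ≤ M := (abs_nonneg _).trans (hVM 0)
  have hprojT : ∀ s ∈ Icc 0 T, (projIcc 0 T hT s : ℝ) = s := fun s hs => by
    rw [projIcc_of_mem hT hs]
  have hprojX : ∀ a ∈ Icc 0 t, (projIcc (-X) X hX (∫ s in a..t, V (u s / L)) : ℝ) =
      ∫ s in a..t, V (u s / L) := by
    intro a ha
    have h1 : |∫ s in a..t, V (u s / L)| ≤ M * |t - a| :=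
      abs_integral_le_of_abs_le_const fun s _ => hVM _
    have h2 : M * |t - a| ≤ M * T := by
      rw [abs_of_nonneg (by linarith [ha.2])]
      gcongr
      linarith [ha.1, ht.2]
    rw [projIcc_of_mem hX (abs_le.mp (h1.trans (h2.trans hMX)))]
  have hVu : Continuous fun s => V (u s / L) := by fun_prop
  have hXc := continuous_integral_left hVu t
  have hpair : Continuous fun τ => (τ, ∫ s in τ..t, V (u s / L)) := continuous_id.prodMk hXc
  have hp : Continuous fun τ => phi τ (∫ s in τ..t, V (u s / L)) := hphi.continuous.comp hpair
  have hp1 : Continuous fun τ => deriv (fun s => phi s (∫ s' in τ..t, V (u s' / L))) τ :=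
    (contDiff_deriv_fst hphi).continuous.comp hpair
  have hp2 : Continuous fun τ => deriv (phi τ) (∫ s in τ..t, V (u s / L)) :=
    (contDiff_deriv_snd hphi).continuous.comp hpair
  have hkb' : ContinuousOn kb (uIcc 0 t) := by
    rw [uIcc_of_le ht.1]
    exact hkb.mono (Icc_subset_Icc_right ht.2)
  have hI1 : IntervalIntegrable (fun τ => V (u τ / L) * kb τ * phi τ (∫ s in τ..t, V (u s / L)) +
      V (u τ / L) * u τ * deriv (phi τ) (∫ s in τ..t, V (u s / L))) volume 0 t :=
    (((hVu.continuousOn.mul hkb').mul hp.continuousOn).add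
      ((hVu.mul hu).mul hp2).continuousOn).intervalIntegrable
  have hI2 : IntervalIntegrable
      (fun τ => u τ * deriv (fun s => phi s (∫ s' in τ..t, V (u s' / L))) τ) volume 0 t :=
    (hu.mul hp1).intervalIntegrable 0 t
  have hker : ∫ τ in (0:ℝ)..t, bathtubIntegrand L V phi (fun t => kb (projIcc 0 T hT t))
      (projIcc 0 T hT τ, u τ, projIcc (-X) X hX (∫ s in τ..t, V (u s / L))) =
      (∫ τ in (0:ℝ)..t, (V (u τ / L) * kb τ * phi τ (∫ s in τ..t, V (u s / L)) +
        V (u τ / L) * u τ * deriv (phi τ) (∫ s in τ..t, V (u s / L)))) -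
      ∫ τ in (0:ℝ)..t, u τ * deriv (fun s => phi s (∫ s' in τ..t, V (u s' / L))) τ := by
    rw [← intervalIntegral.integral_sub hI1 hI2]
    refine intervalIntegral.integral_congr fun τ hτ => ?_
    rw [uIcc_of_le ht.1] at hτ
    simp only [bathtubIntegrand, hprojT τ ⟨hτ.1, hτ.2.trans ht.2⟩, hprojX τ hτ]
  simp only [volterraRHS, volterraOp, hker, hprojT t ht, hprojX 0 ⟨le_rfl, ht.1⟩]
  ring

lemma abs_bathtubIntegrand_le {L M Bb B₀ B₁ B₂ : ℝ} {V b : ℝ → ℝ} {phi : ℝ → ℝ → ℝ}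
    {p : ℝ × ℝ × ℝ} (hV : |V (p.2.1 / L)| ≤ M) (hb : |b p.1| ≤ Bb) (h₀ : |phi p.1 p.2.2| ≤ B₀)
    (h₁ : |deriv (fun s => phi s p.2.2) p.1| ≤ B₁) (h₂ : |deriv (phi p.1) p.2.2| ≤ B₂) :
    |bathtubIntegrand L V phi b p| ≤
      (M * Bb * B₀ + M * B₂ + B₁) + (M * Bb * B₀ + M * B₂ + B₁) * |p.2.1| := by
  have hM : 0 ≤ M := (abs_nonneg _).trans hV
  have hBb : 0 ≤ Bb := (abs_nonneg _).trans hb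
  have hB₀ : 0 ≤ B₀ := (abs_nonneg _).trans h₀
  have hB₁ : 0 ≤ B₁ := (abs_nonneg _).trans h₁
  have hB₂ : 0 ≤ B₂ := (abs_nonneg _).trans h₂
  have e₀ : |V (p.2.1 / L) * b p.1 * phi p.1 p.2.2| ≤ M * Bb * B₀ := by
    rw [abs_mul, abs_mul]
    gcongr
  have e₂ : |V (p.2.1 / L) * p.2.1 * deriv (phi p.1) p.2.2| ≤ M * |p.2.1| * B₂ := by
    rw [abs_mul, abs_mul]
    gcongr
  have e₁ : |p.2.1 * deriv (fun s => phi s p.2.2) p.1| ≤ |p.2.1| * B₁ := by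
    rw [abs_mul]
    gcongr
  have hd := abs_nonneg p.2.1
  have h3 : 0 ≤ M * Bb * B₀ * |p.2.1| := by positivity
  have h4 : 0 ≤ M * B₂ := by positivity
  calc |bathtubIntegrand L V phi b p| ≤ M * Bb * B₀ + M * |p.2.1| * B₂ + |p.2.1| * B₁ :=
        (abs_sub _ _).trans (add_le_add ((abs_add_le _ _).trans (add_le_add e₀ e₂)) e₁)
    _ ≤ _ := by nlinarith

lemma exists_abs_comp_le_of_compact {α β : Type*} [TopologicalSpace β] {f : β → ℝ} {π : α → β}
    {s : Set β} (hf : ContinuousOn f s) (hs : IsCompact s) (h : ∀ x, π x ∈ s) :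
    ∃ B, ∀ x, |f (π x)| ≤ B := by
  obtain ⟨B, hB⟩ := hs.exists_bound_of_continuousOn hf
  exact ⟨B, fun x => hB _ (h x)⟩

/-- The bathtub Volterra equation has a Lipschitz solution, unique among continuous functions. -/
lemma exists_lipschitz_eq_volterraRHS {T L : ℝ} {V kbar kb : ℝ → ℝ} {phi : ℝ → ℝ → ℝ}
    (hA : Assumption2 T L V kbar phi) (hkb_lip : ∃ K : NNReal, LipschitzOnWith K kb (Icc 0 T)) :
    ∃ δ : ℝ → ℝ, (∃ K : NNReal, LipschitzWith K δ) ∧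
      (∀ t ∈ Icc (0:ℝ) T, δ t = volterraRHS L V kbar phi kb δ t) ∧
      ∀ δ' : ℝ → ℝ, ContinuousOn δ' (Icc 0 T) →
        (∀ t ∈ Icc (0:ℝ) T, δ' t = volterraRHS L V kbar phi kb δ' t) →
        ∀ t ∈ Icc (0:ℝ) T, δ' t = δ t := by
  have hT : 0 ≤ T := hA.hT.le
  have hphi := hA.phi_smooth
  obtain ⟨M, hVM⟩ := hA.V_bdd
  obtain ⟨KV, hV⟩ := hA.V_lip
  obtain ⟨Kkb, hkb⟩ := hkb_lip
  have hM : 0 ≤ M := (abs_nonneg _).trans (hVM 0)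
  have hX : -(M * T) ≤ M * T := by linarith [mul_nonneg hM hT]
  set X := M * T with hXdef
  let pT : ℝ → ℝ := fun t => projIcc 0 T hT t
  let pX : ℝ → ℝ := fun x => projIcc (-X) X hX x
  have hpT : LipschitzWith 1 pT := lipschitzWith_coe_projIcc hT
  have hpX : LipschitzWith 1 pX := lipschitzWith_coe_projIcc hX
  have hpTm : ∀ t, pT t ∈ Icc 0 T := fun t => (projIcc 0 T hT t).2
  have hpXm : ∀ x, pX x ∈ Icc (-X) X := fun x => (projIcc (-X) X hX x).2
  let q : ℝ → ℝ := fun t => 1 / phi (pT t) 0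
  let b : ℝ → ℝ := fun t => kb (pT t)
  let H : ℝ → ℝ := fun x => -kbar (pX x) + (∫ y in Ici (0:ℝ), kbar y) * phi 0 (pX x)
  let W : ℝ → ℝ := fun d => V (d / L)
  let g : ℝ × ℝ × ℝ → ℝ := fun p => bathtubIntegrand L V phi b (pT p.1, p.2.1, pX p.2.2)
  have hqloc : LocallyLipschitzOn (Icc 0 T) fun t => 1 / phi t 0 := by
    intro t ht
    have h1 : ContDiff ℝ 1 fun t => phi t 0 :=
      (hphi.of_le (by norm_num)).comp (contDiff_id.prodMk contDiff_const)
    obtain ⟨K, s, hs, h⟩ := ((contDiffAt_const (c := (1:ℝ))).div h1.contDiffAt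
      (hA.phi_pos t ht).ne').exists_lipschitzOnWith
    exact ⟨K, s, mem_nhdsWithin_of_mem_nhds hs, h⟩
  obtain ⟨Kq, hq⟩ : ∃ K, LipschitzWith K q :=
    exists_lipschitzWith_comp_of_compact (f := fun t => 1 / phi t 0) (π := pT) hqloc isCompact_Icc hpT hpTm
  obtain ⟨Q, hQ⟩ : ∃ Q, ∀ t, |q t| ≤ Q :=
    exists_abs_comp_le_of_compact (f := fun t => 1 / phi t 0) (π := pT) hqloc.continuousOn isCompact_Icc hpTm
  obtain ⟨Kb, hb⟩ : ∃ K, LipschitzWith K b := exists_lipschitzWith_comp_of_compact (f := kb)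
    (fun t ht => ⟨Kkb, Icc 0 T, self_mem_nhdsWithin, hkb⟩) isCompact_Icc hpT hpTm
  obtain ⟨Bb, hBb⟩ : ∃ B, ∀ t, |b t| ≤ B :=
    exists_abs_comp_le_of_compact (f := kb) hkb.continuousOn isCompact_Icc hpTm
  let H₀ : ℝ → ℝ := fun x => -kbar x + (∫ y in Ici (0:ℝ), kbar y) * phi 0 x
  have hHC : ContDiff ℝ 1 H₀ :=
    (hA.kbar_smooth.of_le (by norm_num)).neg.add (contDiff_const.mul
      ((hphi.of_le (by norm_num)).comp (contDiff_const.prodMk contDiff_id)))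
  obtain ⟨KH, hH⟩ : ∃ K, LipschitzWith K H :=
    exists_lipschitzWith_comp_of_compact (f := H₀) hHC.locallyLipschitz.locallyLipschitzOn
      isCompact_Icc hpX hpXm
  obtain ⟨BH, hBH⟩ : ∃ B, ∀ t, |H t| ≤ B :=
    exists_abs_comp_le_of_compact (f := H₀) hHC.continuous.continuousOn isCompact_Icc hpXm
  obtain ⟨KW, hW⟩ : ∃ K, LipschitzWith K W := by
    refine ⟨KV * ‖L⁻¹‖₊, hV.comp ?_⟩
    simp_rw [div_eq_inv_mul]
    exact lipschitzWith_smul L⁻¹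
  have hpairm : ∀ p : ℝ × ℝ, (pT p.1, pX p.2) ∈ Icc 0 T ×ˢ Icc (-X) X :=
    fun p => ⟨hpTm _, hpXm _⟩
  have hcomp : IsCompact (Icc 0 T ×ˢ Icc (-X) X) := isCompact_Icc.prod isCompact_Icc
  obtain ⟨B₀, hB₀⟩ := exists_abs_comp_le_of_compact hphi.continuous.continuousOn hcomp hpairm
  obtain ⟨B₁, hB₁⟩ := exists_abs_comp_le_of_compact
    (contDiff_deriv_fst hphi).continuous.continuousOn hcomp hpairm
  obtain ⟨B₂, hB₂⟩ := exists_abs_comp_le_of_compact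
    (contDiff_deriv_snd hphi).continuous.continuousOn hcomp hpairm
  have hbT : ∀ t, |b (pT t)| ≤ Bb := fun t => hBb _
  obtain ⟨A, hgA⟩ : ∃ A, ∀ p, |g p| ≤ A + A * |p.2.1| :=
    ⟨_, fun p => abs_bathtubIntegrand_le (p := (pT p.1, p.2.1, pX p.2.2)) (hVM _) (hbT _)
      (hB₀ (p.1, p.2.2)) (hB₁ (p.1, p.2.2)) (hB₂ (p.1, p.2.2))⟩
  have hA0 : 0 ≤ A := by simpa using (abs_nonneg _).trans (hgA 0)
  have hgloc := locallyLipschitz_bathtubIntegrand (L := L) hV hphi hb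
  have hgc : Continuous g := hgloc.continuous.comp
    ((hpT.continuous.comp continuous_fst).prodMk ((continuous_fst.comp continuous_snd).prodMk
      (hpX.continuous.comp (continuous_snd.comp continuous_snd))))
  set B := max Bb BH
  have hbB : ∀ t, |b t| ≤ B := fun t => (hBb t).trans (le_max_left _ _)
  have hHB : ∀ x, |H x| ≤ B := fun x => (hBH x).trans (le_max_right _ _)
  -- an a priori bound, valid both for the original and for the truncated equation
  obtain ⟨R, hR0, hR⟩ : ∃ R, 0 ≤ R ∧ ∀ g' : ℝ × ℝ × ℝ → ℝ, Continuous g' →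
      (∀ p, |g' p| ≤ A + A * |p.2.1|) → ∀ u : ℝ → ℝ, Continuous u →
      (∀ t ∈ Icc 0 T, u t = volterraOp q b H W g' u t) → ∀ t ∈ Icc 0 T, |u t| ≤ R :=
    ⟨_, le_max_left _ _, fun g' hg' hg'A u hu heq t ht =>
      (abs_le_of_eq_volterraOp hT hQ hbB hHB hW.continuous hg' hg'A hu heq t ht).trans
        (le_max_right 0 _)⟩
  have hRR : -R ≤ R := by linarith
  let pR : ℝ → ℝ := fun x => projIcc (-R) R hRR x
  have hpR : LipschitzWith 1 pR := lipschitzWith_coe_projIcc hRR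
  have hpRm : ∀ x, pR x ∈ Icc (-R) R := fun x => (projIcc (-R) R hRR x).2
  have hpRe : ∀ x, |x| ≤ R → pR x = x := fun x hx => by
    simp only [pR, projIcc_of_mem hRR (abs_le.mp hx)]
  let gR : ℝ × ℝ × ℝ → ℝ := fun p => g (p.1, pR p.2.1, p.2.2)
  let π : ℝ × ℝ × ℝ → ℝ × ℝ × ℝ := fun p => (pT p.1, pR p.2.1, pX p.2.2)
  have hπm : ∀ p, π p ∈ Icc 0 T ×ˢ Icc (-R) R ×ˢ Icc (-X) X :=
    fun p => ⟨hpTm _, hpRm _, hpXm _⟩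
  have hcomp3 : IsCompact (Icc 0 T ×ˢ Icc (-R) R ×ˢ Icc (-X) X) :=
    isCompact_Icc.prod (isCompact_Icc.prod isCompact_Icc)
  have hπ := (hpT.comp LipschitzWith.prod_fst).prodMk
    ((hpR.comp (LipschitzWith.prod_fst.comp LipschitzWith.prod_snd)).prodMk
      (hpX.comp (LipschitzWith.prod_snd.comp (LipschitzWith.prod_snd (α := ℝ) (β := ℝ × ℝ)))))
  obtain ⟨Kg, hg⟩ : ∃ K, LipschitzWith K gR :=
    exists_lipschitzWith_comp_of_compact (π := π) hgloc.locallyLipschitzOn hcomp3 hπ hπm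
  obtain ⟨Bg, hBg⟩ : ∃ B, ∀ p, |gR p| ≤ B :=
    exists_abs_comp_le_of_compact (π := π) hgloc.continuous.continuousOn hcomp3 hπm
  have hgRA : ∀ p, |gR p| ≤ A + A * |p.2.1| := fun p => (hgA _).trans
    (add_le_add_right (mul_le_mul_of_nonneg_left (abs_projIcc_le_abs hRR _) hA0) A)
  -- for functions bounded by `R` the truncation is invisible
  have htrunc : ∀ u : ℝ → ℝ, (∀ t ∈ Icc 0 T, |u t| ≤ R) → ∀ t ∈ Icc 0 T,
      volterraOp q b H W gR u t = volterraOp q b H W g u t := by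
    intro u hu t ht
    have : ∫ τ in (0:ℝ)..t, gR (τ, u τ, ∫ s in τ..t, W (u s)) =
        ∫ τ in (0:ℝ)..t, g (τ, u τ, ∫ s in τ..t, W (u s)) := by
      refine intervalIntegral.integral_congr fun τ hτ => ?_
      rw [uIcc_of_le ht.1] at hτ
      simp only [gR, hpRe _ (hu τ ⟨hτ.1, hτ.2.trans ht.2⟩)]
    simp only [volterraOp, this]
  have hRHS : ∀ u : ℝ → ℝ, Continuous u → ∀ t ∈ Icc 0 T,
      volterraRHS L V kbar phi kb u t = volterraOp q b H W g u t :=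
    fun u hu t ht => volterraRHS_eq_volterraOp hT hX hXdef.ge hV.continuous hVM hphi
      hkb.continuousOn hu ht
  obtain ⟨u, hu, huniq⟩ := existsUnique_eq_volterraOp hT hq hQ hb hH hW (fun x => hVM _) hg hBg
  have huc : Continuous (IccExtend hT u) := u.continuous.Icc_extend'
  have huR := hR gR hg.continuous hgRA _ huc hu
  refine ⟨IccExtend hT u, ?_, fun t ht => ?_, fun δ' hδ' hsol t ht => ?_⟩
  · obtain ⟨K, hK⟩ := exists_lipschitzOnWith_volterraOp (T := T) hq hb hH hW (fun x => hVM _)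
      hg hBg huc
    have hK' : LipschitzOnWith K (IccExtend hT u) (Icc 0 T) := fun s hs t ht => by
      rw [hu s hs, hu t ht]
      exact hK hs ht
    have heq : (fun t => IccExtend hT u (pT t)) = IccExtend hT u :=
      funext fun t => congrArg u (projIcc_val hT _)
    rw [← heq]
    exact exists_lipschitzWith_comp_of_compact (f := IccExtend hT u)
      (fun t ht => ⟨K, Icc 0 T, self_mem_nhdsWithin, hK'⟩) isCompact_Icc hpT hpTm
  · rw [hRHS _ huc t ht, ← htrunc _ huR t ht]
    exact hu t ht
  · let u' : C(Icc 0 T, ℝ) := ⟨(Icc 0 T).domRestrict δ', hδ'.domRestrict⟩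
    have hu'c : Continuous (IccExtend hT u') := u'.continuous.Icc_extend'
    have hext : EqOn δ' (IccExtend hT u') (Icc 0 T) := fun s hs =>
      (IccExtend_of_mem hT u' hs).symm
    have hu' : ∀ t ∈ Icc 0 T, IccExtend hT u' t = volterraOp q b H W g (IccExtend hT u') t :=
      fun t ht => by
        rw [← hRHS _ hu'c t ht, ← volterraRHS_congr hext ht, ← hext ht]
        exact hsol t ht
    have hu'R := hR g hgc hgA _ hu'c hu'
    rw [hext ht, huniq u' fun t ht => (hu' t ht).trans (htrunc _ hu'R t ht).symm]

theorem stmt13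
    (T L : ℝ) (V kbar : ℝ → ℝ) (phi : ℝ → ℝ → ℝ) (kb : ℝ → ℝ)
    (hA : Assumption2 T L V kbar phi)
    -- observational data k(·,0) ∈ W^{1,∞}([0,T]), i.e. Lipschitz on [0,T]
    (hkb_lip : ∃ K : NNReal, LipschitzOnWith K kb (Icc 0 T)) :
    ∃ δ : ℝ → ℝ,
      -- δ ∈ W^{1,∞}([0,T])
      (∃ K : NNReal, LipschitzOnWith K δ (Icc 0 T)) ∧
      -- δ solves the Volterra integral equation
      (∀ t ∈ Icc (0:ℝ) T, δ t = volterraRHS L V kbar phi kb δ t) ∧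
      -- uniqueness of δ
      (∀ δ' : ℝ → ℝ, (∃ K : NNReal, LipschitzOnWith K δ' (Icc 0 T)) →
        (∀ t ∈ Icc (0:ℝ) T, δ' t = volterraRHS L V kbar phi kb δ' t) →
        ∀ t ∈ Icc (0:ℝ) T, δ' t = δ t) ∧
      -- a unique f ∈ L^∞([0,T]) recovered via f = δ' + V(δ/L) k(·,0),
      -- expressed in the (equivalent) integrated form
      ∃ f : ℝ → ℝ, Measurable f ∧ (∃ M : ℝ, ∀ t ∈ Icc (0:ℝ) T, |f t| ≤ M) ∧
        (∀ t ∈ Icc (0:ℝ) T, δ t = δ 0 + ∫ τ in (0:ℝ)..t, (f τ - V (δ τ / L) * kb τ)) ∧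
        ∀ f' : ℝ → ℝ, Measurable f' → (∃ M : ℝ, ∀ t ∈ Icc (0:ℝ) T, |f' t| ≤ M) →
          (∀ t ∈ Icc (0:ℝ) T, δ t = δ 0 + ∫ τ in (0:ℝ)..t, (f' τ - V (δ τ / L) * kb τ)) →
          ∀ t ∈ Icc (0:ℝ) T, (∫ τ in (0:ℝ)..t, f' τ) = ∫ τ in (0:ℝ)..t, f τ := by
  obtain ⟨δ, ⟨K, hK⟩, hsol, huniq⟩ := exists_lipschitz_eq_volterraRHS hA hkb_lip
  obtain ⟨Kkb, hkb⟩ := hkb_lip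
  obtain ⟨M, hVM⟩ := hA.V_bdd
  have hM : 0 ≤ M := (abs_nonneg _).trans (hVM 0)
  obtain ⟨KV, hV⟩ := hA.V_lip
  have hT : 0 ≤ T := hA.hT.le
  obtain ⟨Bk, hBk⟩ := isCompact_Icc.exists_bound_of_continuousOn hkb.continuousOn
  have hkbc : Continuous fun t => kb (projIcc 0 T hT t) :=
    hkb.continuousOn.comp_continuous (continuous_subtype_val.comp continuous_projIcc)
      fun t => (projIcc 0 T hT t).2
  have hVδ : Continuous fun t => V (δ t / L) := hV.continuous.comp (hK.continuous.div_const L)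
  have hproj : ∀ t ∈ Icc 0 T, (projIcc 0 T hT t : ℝ) = t := fun t ht => by
    rw [projIcc_of_mem hT ht]
  have hsub : ∀ t ∈ Icc 0 T, ∀ τ ∈ uIcc 0 t, τ ∈ Icc 0 T := by
    intro t ht τ hτ
    rw [uIcc_of_le ht.1] at hτ
    exact ⟨hτ.1, hτ.2.trans ht.2⟩
  have hflux : ∀ t ∈ Icc 0 T, IntervalIntegrable (fun τ => V (δ τ / L) * kb τ) volume 0 t :=
    fun t ht => (hVδ.continuousOn.mul
      (hkb.continuousOn.mono (hsub t ht))).intervalIntegrable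
  have hinteg : ∀ f : ℝ → ℝ, Measurable f → (∃ M : ℝ, ∀ t ∈ Icc (0:ℝ) T, |f t| ≤ M) →
      ∀ t ∈ Icc 0 T, IntervalIntegrable f volume 0 t := by
    rintro f hf ⟨C, hC⟩ t ht
    refine (intervalIntegrable_const (c := C)).mono_fun hf.aestronglyMeasurable ?_
    refine (ae_restrict_iff' measurableSet_uIoc).mpr (Eventually.of_forall fun τ hτ => ?_)
    exact (hC τ (hsub t ht τ (uIoc_subset_uIcc hτ))).trans (le_abs_self C)
  let f : ℝ → ℝ := fun t => deriv δ t + V (δ t / L) * kb (projIcc 0 T hT t)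
  have hfm : Measurable f := (measurable_deriv δ).add (hVδ.mul hkbc).measurable
  have hfb : ∃ C : ℝ, ∀ t ∈ Icc (0:ℝ) T, |f t| ≤ C := by
    refine ⟨K + M * Bk, fun t ht => (abs_add_le _ _).trans (add_le_add ?_ ?_)⟩
    · exact norm_deriv_le_of_lipschitz hK
    · rw [abs_mul]
      gcongr
      · exact hVM _
      · exact hBk _ (projIcc 0 T hT t).2
  have hfeq : ∀ t ∈ Icc (0:ℝ) T,
      δ t = δ 0 + ∫ τ in (0:ℝ)..t, (f τ - V (δ τ / L) * kb τ) := by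
    intro t ht
    have h1 : ∫ τ in (0:ℝ)..t, (f τ - V (δ τ / L) * kb τ) = ∫ τ in (0:ℝ)..t, deriv δ τ := by
      refine intervalIntegral.integral_congr fun τ hτ => ?_
      simp only [f, hproj τ (hsub t ht τ hτ), add_sub_cancel_right]
    rw [h1, (hK.lipschitzOnWith.absolutelyContinuousOnInterval).integral_deriv_eq_sub]
    ring
  refine ⟨δ, ⟨K, hK.lipschitzOnWith⟩, hsol, fun δ' ⟨K', hK'⟩ => huniq δ' hK'.continuousOn,
    f, hfm, hfb, hfeq, fun f' hf'm hf'b hf'eq t ht => ?_⟩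
  have h1 := hfeq t ht
  have h2 := hf'eq t ht
  rw [intervalIntegral.integral_sub (hinteg f hfm hfb t ht) (hflux t ht)] at h1
  rw [intervalIntegral.integral_sub (hinteg f' hf'm hf'b t ht) (hflux t ht)] at h2
  linarith
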